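/- arXiv:1507.05710 — 2 statements merged into one kernel-verified Lean document; each statement's English description precedes it below -/
import Mathlib

section
/- Regarded as a linear endomorphism of $\mathbb{Q}^{27}$ (the rational vector space with basis the $27$ exceptional vectors), the incidence matrix $A$ is diagonalizable with eigenvalues $10$, $1$ and $-5$: the kernel of $A-10I$ has dimension $1$ (spanned by the all-ones vector), the kernel of $A-I$ has dimension $20$, and the kernel of $A+5I$ has dimension $6$. -/
/-- The symmetric bilinear form on `ℤ^{1,6}`: `⟨x,y⟩ = x₀y₀ - ∑_{i=1}^{6} xᵢyᵢ`. -/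
def form (x y : Fin 7 → ℤ) : ℤ := 2 * (x 0 * y 0) - ∑ i, x i * y i

/-- The standard basis vector `f i` of `V = ℤ⁷`. -/
def fvec (i : Fin 7) : Fin 7 → ℤ := fun j => if j = i then 1 else 0

/-- The canonical vector `k = -3f₀ + f₁ + ⋯ + f₆`. -/
def kvec : Fin 7 → ℤ := fun i => if i = 0 then -3 else 1

/-- A root of the `E₆` lattice: a vector `r` with `⟨r,k⟩ = 0` and `⟨r,r⟩ = -2`. -/
def IsRoot (r : Fin 7 → ℤ) : Prop := form r kvec = 0 ∧ form r r = -2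

/-- An exceptional vector: a vector `ℓ` with `⟨ℓ,ℓ⟩ = -1` and `⟨ℓ,k⟩ = -1`. -/
def IsExc (l : Fin 7 → ℤ) : Prop := form l l = -1 ∧ form l kvec = -1

/-- The type of exceptional vectors (there are `27` of them). -/
abbrev ExcT : Type := {l : Fin 7 → ℤ // IsExc l}

/-- The incidence matrix of the `27` lines over `ℚ`: entry `1` if `⟨ℓ,ℓ'⟩ = 1`, else `0`. -/
def incMatQ : Matrix ExcT ExcT ℚ :=
  Matrix.of fun l l' => if form l.1 l'.1 = 1 then 1 else 0

/-- The list of the 27 exceptional vectors. -/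
def excVec : Fin 27 → Fin 7 → ℤ :=
  ![![0, 1, 0, 0, 0, 0, 0],
    ![0, 0, 1, 0, 0, 0, 0],
    ![0, 0, 0, 1, 0, 0, 0],
    ![0, 0, 0, 0, 1, 0, 0],
    ![0, 0, 0, 0, 0, 1, 0],
    ![0, 0, 0, 0, 0, 0, 1],
    ![1, -1, -1, 0, 0, 0, 0],
    ![1, -1, 0, -1, 0, 0, 0],
    ![1, -1, 0, 0, -1, 0, 0],
    ![1, -1, 0, 0, 0, -1, 0],
    ![1, -1, 0, 0, 0, 0, -1],
    ![1, 0, -1, -1, 0, 0, 0],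
    ![1, 0, -1, 0, -1, 0, 0],
    ![1, 0, -1, 0, 0, -1, 0],
    ![1, 0, -1, 0, 0, 0, -1],
    ![1, 0, 0, -1, -1, 0, 0],
    ![1, 0, 0, -1, 0, -1, 0],
    ![1, 0, 0, -1, 0, 0, -1],
    ![1, 0, 0, 0, -1, -1, 0],
    ![1, 0, 0, 0, -1, 0, -1],
    ![1, 0, 0, 0, 0, -1, -1],
    ![2, 0, -1, -1, -1, -1, -1],
    ![2, -1, 0, -1, -1, -1, -1],
    ![2, -1, -1, 0, -1, -1, -1],
    ![2, -1, -1, -1, 0, -1, -1],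
    ![2, -1, -1, -1, -1, 0, -1],
    ![2, -1, -1, -1, -1, -1, 0]]

set_option linter.unusedSimpArgs false

theorem excVec_isExc : ∀ i, form (excVec i) (excVec i) = -1 ∧ form (excVec i) kvec = -1 := by
  decide +kernel

theorem excVec_inj : ∀ i j, excVec i = excVec j → i = j := by
  decide +kernel

/-- The incidence matrix in coordinates. -/
def adj (i j : Fin 27) : ℤ := if form (excVec i) (excVec j) = 1 then 1 else 0

theorem adj_diag : ∀ i, adj i i = 0 := by decide +kernel

theorem adj_row : ∀ i, ∑ j, adj i j = 10 := by decide +kernel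

theorem adj_eq : ∀ i j, adj i j = form (excVec i) (excVec j) + if i = j then 1 else 0 := by
  decide +kernel

theorem form_expand (x y : Fin 7 → ℤ) : form x y = x 0 * y 0 - x 1 * y 1 - x 2 * y 2 - x 3 * y 3
    - x 4 * y 4 - x 5 * y 5 - x 6 * y 6 := by
  rw [form, Fin.sum_univ_seven]
  ring

theorem form_sq (x y : Fin 7 → ℤ) : ∑ k, form x (excVec k) * form (excVec k) y =
    -6 * form x y + 5 * (form x kvec * form y kvec) := by
  simp only [form_expand]
  simp [Fin.sum_univ_succ, excVec, kvec]
  ring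

theorem adj_sq (i j : Fin 27) :
    ∑ k, adj i k * adj k j = 5 * (if i = j then 1 else 0) - 4 * adj i j + 5 := by
  have h := form_sq (excVec i) (excVec j)
  rw [(excVec_isExc i).2, (excVec_isExc j).2] at h
  simp only [adj_eq, add_mul, mul_add, Finset.sum_add_distrib, h]
  simp
  split_ifs <;> ring

theorem bits_cover : ∀ c : Fin 3, ∀ b : Fin 6 → Bool,
    (∑ i, if b i then (1 : ℤ) else 0) = ![1, 2, 5] c →
    ∃ n, excVec n 0 = ![0, 1, 2] c ∧
      ∀ i : Fin 6, excVec n i.succ = if b i then ![1, -1, -1] c else 0 := by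
  decide +kernel

theorem sq_fin (x : ℤ) (h : x * x - x ≤ 0) : x = 0 ∨ x = 1 := by
  have h1 : 0 ≤ x := by nlinarith
  have h2 : x ≤ 1 := by nlinarith
  omega

theorem self_le_sq (x : ℤ) : x ≤ x * x := by
  rcases le_or_gt x 0 with h | h <;> nlinarith

theorem cover_aux (l : Fin 7 → ℤ) (c : Fin 3) (e : ℤ) (he : e = ![1, -1, -1] c)
    (h0 : l 0 = ![0, 1, 2] c) (hs : ∑ i : Fin 6, e * l i.succ = ![1, 2, 5] c)
    (hq : ∑ i : Fin 6, l i.succ * l i.succ = ![1, 2, 5] c) : ∃ n, excVec n = l := by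
  have hee : e * e = 1 := by
    rw [he]; clear * -; revert c; decide
  have hz : ∑ i : Fin 6, ((e * l i.succ) * (e * l i.succ) - e * l i.succ) = 0 := by
    rw [Finset.sum_sub_distrib, hs, ← hq, sub_eq_zero]
    refine Finset.sum_congr rfl fun i _ => ?_
    linear_combination (l i.succ * l i.succ) * hee
  have hb : ∀ i : Fin 6, e * l i.succ = 0 ∨ e * l i.succ = 1 := by
    intro i
    apply sq_fin
    rw [← hz]
    exact Finset.single_le_sum
      (f := fun i : Fin 6 => (e * l i.succ) * (e * l i.succ) - e * l i.succ)
      (fun j _ => sub_nonneg.2 (self_le_sq _)) (Finset.mem_univ i)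
  obtain ⟨n, hn0, hn⟩ := bits_cover c (fun i => decide (e * l i.succ = 1)) (by
    rw [← hs]
    refine Finset.sum_congr rfl fun i _ => ?_
    rcases hb i with h | h <;> simp [h])
  refine ⟨n, funext fun j => ?_⟩
  refine Fin.cases (by rw [hn0, h0]) (fun i => ?_) j
  rw [hn i, ← he]
  have hl : l i.succ = e * (e * l i.succ) := by rw [← mul_assoc, hee, one_mul]
  rcases hb i with h | h
  · rw [if_neg (by simp [h]), hl, h, mul_zero]
  · rw [if_pos (by simp [h]), hl, h, mul_one]

theorem excVec_surj (l : Fin 7 → ℤ) (h : IsExc l) : ∃ n, excVec n = l := by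
  obtain ⟨h1, h2⟩ := h
  have hq : ∑ i : Fin 6, l i.succ * l i.succ = l 0 * l 0 + 1 := by
    unfold form at h1
    rw [Fin.sum_univ_succ] at h1
    linarith
  have hs : ∑ i : Fin 6, l i.succ = 1 - 3 * l 0 := by
    unfold form at h2
    rw [Fin.sum_univ_succ] at h2
    simp [kvec] at h2
    linarith
  have hcs : (1 - 3 * l 0) ^ 2 ≤ 6 * (l 0 * l 0 + 1) := by
    have := sq_sum_le_card_mul_sum_sq (s := Finset.univ) (f := fun i : Fin 6 => l i.succ)
    simp only [pow_two (l _)] at this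
    rw [hs, hq] at this
    simpa using this
  have ha : 0 ≤ l 0 := by nlinarith
  have hb : l 0 ≤ 2 := by nlinarith
  have hc : l 0 = 0 ∨ l 0 = 1 ∨ l 0 = 2 := by omega
  rcases hc with hc | hc | hc
  · exact cover_aux l 0 1 rfl hc (by rw [← Finset.mul_sum, hs, hc]; rfl) (by rw [hq, hc]; rfl)
  · exact cover_aux l 1 (-1) rfl hc (by rw [← Finset.mul_sum, hs, hc]; rfl) (by rw [hq, hc]; rfl)
  · exact cover_aux l 2 (-1) rfl hc (by rw [← Finset.mul_sum, hs, hc]; rfl) (by rw [hq, hc]; rfl)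

/-- The enumeration as an equivalence. -/
noncomputable def excEquiv : Fin 27 ≃ ExcT :=
  Equiv.ofBijective (fun i => ⟨excVec i, excVec_isExc i⟩)
    ⟨fun i j h => excVec_inj i j (congrArg Subtype.val h),
      fun l => (excVec_surj l.1 l.2).imp fun _ h => Subtype.ext h⟩

theorem incMatQ_equiv (i j : Fin 27) : incMatQ (excEquiv i) (excEquiv j) = (adj i j : ℚ) := by
  have h : ∀ n, (excEquiv n).1 = excVec n := fun _ => rfl
  simp [incMatQ, adj, h]

theorem inc_diag (l : ExcT) : incMatQ l l = 0 := by
  obtain ⟨i, rfl⟩ := excEquiv.surjective l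
  rw [incMatQ_equiv, adj_diag, Int.cast_zero]

theorem inc_row [Fintype ExcT] (l : ExcT) : ∑ m, incMatQ l m = 10 := by
  obtain ⟨i, rfl⟩ := excEquiv.surjective l
  rw [← excEquiv.sum_comp]
  simp only [incMatQ_equiv]
  exact_mod_cast adj_row i

theorem inc_sq [Fintype ExcT] :
    incMatQ * incMatQ = (5 : ℚ) • (1 : Matrix ExcT ExcT ℚ) - (4 : ℚ) • incMatQ
      + (5 : ℚ) • Matrix.of fun _ _ => (1 : ℚ) := by
  ext l m
  obtain ⟨i, rfl⟩ := excEquiv.surjective l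
  obtain ⟨j, rfl⟩ := excEquiv.surjective m
  rw [Matrix.mul_apply, ← excEquiv.sum_comp]
  simp only [incMatQ_equiv, Matrix.add_apply, Matrix.sub_apply, Matrix.smul_apply, Matrix.one_apply,
    Matrix.of_apply, smul_eq_mul, excEquiv.injective.eq_iff, mul_one]
  exact_mod_cast adj_sq i j

theorem exc_card [Fintype ExcT] : Fintype.card ExcT = 27 := by
  rw [← Fintype.card_congr excEquiv, Fintype.card_fin]

theorem finrank_of_proj [Fintype ExcT] (B E : Matrix ExcT ExcT ℚ) (h0 : B * E = 0)
    (C : Matrix ExcT ExcT ℚ) (h1 : E = 1 + C * B) (d : ℕ) (ht : E.trace = d) :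
    Module.finrank ℚ (LinearMap.ker B.mulVecLin) = d := by
  have hp : LinearMap.IsProj (LinearMap.ker B.mulVecLin) E.mulVecLin := by
    constructor
    · intro x
      simp [LinearMap.mem_ker, Matrix.mulVec_mulVec, h0]
    · intro x hx
      have hx' : B.mulVec x = 0 := by simpa using hx
      simp [h1, Matrix.add_mulVec, ← Matrix.mulVec_mulVec, hx']
  have h := hp.trace
  rw [← Matrix.toLin'_apply', Matrix.trace_toLin'_eq, ht] at h
  exact_mod_cast h.symm

/-- As an endomorphism of `ℚ^{27}`, the incidence matrix `A` is diagonalizable with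
eigenvalues `10`, `1`, `-5`: it satisfies `(A-10)(A-1)(A+5)=0`, the kernel of `A - 10I`
is the line spanned by the all-ones vector (dimension `1`), the kernel of `A - I` has
dimension `20` and the kernel of `A + 5I` has dimension `6`. -/
theorem stmt_6 [Fintype ExcT] :
    (incMatQ - 10) * (incMatQ - 1) * (incMatQ + 5) = 0 ∧
    LinearMap.ker (incMatQ - 10).mulVecLin =
      Submodule.span ℚ {(fun _ => (1 : ℚ) : ExcT → ℚ)} ∧
    Module.finrank ℚ (LinearMap.ker (incMatQ - 10).mulVecLin) = 1 ∧
    Module.finrank ℚ (LinearMap.ker (incMatQ - 1).mulVecLin) = 20 ∧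
    Module.finrank ℚ (LinearMap.ker (incMatQ + 5).mulVecLin) = 6 := by
  have num : ∀ n : ℕ, ∀ [n.AtLeastTwo],
      (OfNat.ofNat n : Matrix ExcT ExcT ℚ) = (OfNat.ofNat n : ℚ) • (1 : Matrix ExcT ExcT ℚ) := by
    intro n _
    rw [← Nat.cast_ofNat, ← Nat.cast_ofNat (R := ℚ), Nat.cast_smul_eq_nsmul, nsmul_one]
  have hsq := inc_sq
  have hAJ : incMatQ * (Matrix.of fun _ _ => (1 : ℚ)) =
      (10 : ℚ) • (Matrix.of fun _ _ => (1 : ℚ) : Matrix ExcT ExcT ℚ) := by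
    ext l m
    simp [Matrix.mul_apply, inc_row]
  have hcube : incMatQ * (incMatQ * incMatQ) = (6 : ℚ) • (incMatQ * incMatQ)
      + (45 : ℚ) • incMatQ - (50 : ℚ) • (1 : Matrix ExcT ExcT ℚ) := by
    rw [hsq, mul_add, mul_sub, mul_smul_comm, mul_smul_comm, mul_smul_comm, hAJ, hsq, mul_one]
    module
  have htA : incMatQ.trace = 0 := by simp [Matrix.trace, inc_diag]
  have ht1 : (1 : Matrix ExcT ExcT ℚ).trace = 27 := by simp [exc_card]
  have htS : (incMatQ * incMatQ).trace = 270 := by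
    have hJ : (Matrix.of fun _ _ => (1 : ℚ) : Matrix ExcT ExcT ℚ).trace = 27 := by
      simp [Matrix.trace, exc_card]
    rw [hsq, Matrix.trace_add, Matrix.trace_sub, Matrix.trace_smul, Matrix.trace_smul,
      Matrix.trace_smul, htA, ht1, hJ]
    norm_num
  have hprod : (incMatQ - 10) * (incMatQ - 1) * (incMatQ + 5) = 0 := by
    rw [num 10, num 5]
    simp only [mul_add, add_mul, mul_sub, sub_mul, mul_smul_comm, smul_mul_assoc, mul_one, one_mul,
      mul_assoc, hcube]
    module
  have hd10 : Module.finrank ℚ (LinearMap.ker (incMatQ - 10).mulVecLin) = 1 := by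
    refine finrank_of_proj _ ((1 / 135 : ℚ) • (incMatQ * incMatQ + (4 : ℚ) • incMatQ - (5 : ℚ) • 1))
      ?_ ((1 / 135 : ℚ) • (incMatQ + (14 : ℚ) • 1)) ?_ 1 ?_
    · rw [num 10]
      simp only [mul_add, add_mul, mul_sub, sub_mul, mul_smul_comm, smul_mul_assoc, mul_one,
        one_mul, mul_assoc, hcube]
      module
    · rw [num 10]
      simp only [mul_add, add_mul, mul_sub, sub_mul, mul_smul_comm, smul_mul_assoc, mul_one,
        one_mul, mul_assoc]
      module
    · simp only [Matrix.trace_add, Matrix.trace_sub, Matrix.trace_smul, htA, ht1, htS, smul_eq_mul]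
      norm_num
  refine ⟨hprod, ?_, hd10, ?_, ?_⟩
  · symm
    apply Submodule.eq_of_le_of_finrank_eq
    · rw [Submodule.span_singleton_le_iff_mem, LinearMap.mem_ker, num 10]
      ext l
      simp [Matrix.sub_mulVec, Matrix.smul_mulVec, Matrix.mulVec, dotProduct, inc_row,
        Matrix.one_apply]
    · rw [hd10]
      apply finrank_span_singleton
      intro h
      have := congrFun h (excEquiv 0)
      simp at this
  · refine finrank_of_proj _
      ((-1 / 54 : ℚ) • (incMatQ * incMatQ - (5 : ℚ) • incMatQ - (50 : ℚ) • 1))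
      ?_ ((-1 / 54 : ℚ) • (incMatQ - (4 : ℚ) • 1)) ?_ 20 ?_
    · simp only [mul_add, add_mul, mul_sub, sub_mul, mul_smul_comm, smul_mul_assoc, mul_one,
        one_mul, mul_assoc, hcube]
      module
    · simp only [mul_add, add_mul, mul_sub, sub_mul, mul_smul_comm, smul_mul_assoc, mul_one,
        one_mul, mul_assoc]
      module
    · simp only [Matrix.trace_add, Matrix.trace_sub, Matrix.trace_smul, htA, ht1, htS, smul_eq_mul]
      norm_num
  · refine finrank_of_proj _
      ((1 / 90 : ℚ) • (incMatQ * incMatQ - (11 : ℚ) • incMatQ + (10 : ℚ) • 1))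
      ?_ ((1 / 90 : ℚ) • (incMatQ - (16 : ℚ) • 1)) ?_ 6 ?_
    · rw [num 5]
      simp only [mul_add, add_mul, mul_sub, sub_mul, mul_smul_comm, smul_mul_assoc, mul_one,
        one_mul, mul_assoc, hcube]
      module
    · rw [num 5]
      simp only [mul_add, add_mul, mul_sub, sub_mul, mul_smul_comm, smul_mul_assoc, mul_one,
        one_mul, mul_assoc]
      module
    · simp only [Matrix.trace_add, Matrix.trace_sub, Matrix.trace_smul, htA, ht1, htS, smul_eq_mul]
      norm_num
end

section
/- Let $r,r'$ be roots with $\langle r,r'\rangle=0$ and $r'\ne\pm r$ (a syzygetic pair). Then the composition $s_r\circ s_{r'}$ permutes the set $L$ of $27$ exceptional vectors, is an involution on $L$ different from the identity, and has exactly $7$ fixed points in $L$; equivalently, its cycle type on $L$ is $(2^{10},1^7)$, a product of ten disjoint transpositions. -/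
/-- The reflection in a root `r`, as a plain function: `x ↦ x + ⟨x,r⟩ r`. -/
def reflFun (r : Fin 7 → ℤ) (x : Fin 7 → ℤ) : Fin 7 → ℤ := x + form x r • r

theorem form_kvec (x : Fin 7 → ℤ) :
    form x kvec = -3 * x 0 - x 1 - x 2 - x 3 - x 4 - x 5 - x 6 := by
  rw [form_expand]; simp [kvec]; ring

theorem form_add_left (x y z : Fin 7 → ℤ) : form (x + y) z = form x z + form y z := by
  simp only [form_expand, Pi.add_apply]; ring

theorem form_smul_left (c : ℤ) (x z : Fin 7 → ℤ) : form (c • x) z = c * form x z := by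
  simp only [form_expand, Pi.smul_apply, smul_eq_mul]; ring

theorem form_comm' (x y : Fin 7 → ℤ) : form x y = form y x := by
  simp only [form_expand]; ring

theorem form_add_right (x y z : Fin 7 → ℤ) : form x (y + z) = form x y + form x z := by
  simp only [form_expand, Pi.add_apply]; ring

theorem form_smul_right (c : ℤ) (x z : Fin 7 → ℤ) : form x (c • z) = c * form x z := by
  simp only [form_expand, Pi.smul_apply, smul_eq_mul]; ring

/-- The form is negative semidefinite on the orthogonal complement of `k`. -/
theorem form_nonpos (v : Fin 7 → ℤ) (h : form v kvec = 0) : form v v ≤ 0 := by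
  rw [form_kvec] at h
  rw [form_expand]
  have h0 : 3 * v 0 = -(v 1 + v 2 + v 3 + v 4 + v 5 + v 6) := by linarith
  have h1 : 9 * (v 0 * v 0) = (v 1 + v 2 + v 3 + v 4 + v 5 + v 6) ^ 2 := by
    have : (3 * v 0) ^ 2 = (v 1 + v 2 + v 3 + v 4 + v 5 + v 6) ^ 2 := by rw [h0]; ring
    linarith
  linarith [sq_nonneg (v 1 - v 2), sq_nonneg (v 1 - v 3), sq_nonneg (v 1 - v 4),
    sq_nonneg (v 1 - v 5), sq_nonneg (v 1 - v 6), sq_nonneg (v 2 - v 3), sq_nonneg (v 2 - v 4),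
    sq_nonneg (v 2 - v 5), sq_nonneg (v 2 - v 6), sq_nonneg (v 3 - v 4), sq_nonneg (v 3 - v 5),
    sq_nonneg (v 3 - v 6), sq_nonneg (v 4 - v 5), sq_nonneg (v 4 - v 6), sq_nonneg (v 5 - v 6),
    sq_nonneg (v 1), sq_nonneg (v 2), sq_nonneg (v 3), sq_nonneg (v 4), sq_nonneg (v 5),
    sq_nonneg (v 6)]

/-- An exceptional vector meets a root in `-1`, `0` or `1`. -/
theorem form_exc_root (l r : Fin 7 → ℤ) (hl : IsExc l) (hr : IsRoot r) :
    form l r = -1 ∨ form l r = 0 ∨ form l r = 1 := by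
  have hkk : form kvec kvec = 3 := by rw [form_kvec]; simp [kvec]
  have hkr : form kvec r = 0 := by rw [form_comm']; exact hr.1
  have hkl : form kvec l = -1 := by rw [form_comm']; exact hl.2
  have hrl : form r l = form l r := form_comm' _ _
  have key := form_nonpos ((6 : ℤ) • l + (2 : ℤ) • kvec + (3 * form l r) • r) (by
    simp only [form_add_left, form_smul_left, hl.2, hr.1, hkk]; ring)
  simp only [form_add_left, form_smul_left, form_add_right, form_smul_right, hl.1, hl.2, hr.1,
    hr.2, hkk, hkr, hkl, hrl] at key
  generalize form l r = m at *
  have h1 : m < 2 := by nlinarith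
  have h2 : -2 < m := by nlinarith
  omega

/-- The 27 exceptional vectors. -/
def excList : List (Fin 7 → ℤ) :=
  [![0,1,0,0,0,0,0], ![0,0,1,0,0,0,0], ![0,0,0,1,0,0,0], ![0,0,0,0,1,0,0], ![0,0,0,0,0,1,0],
   ![0,0,0,0,0,0,1],
   ![1,-1,-1,0,0,0,0], ![1,-1,0,-1,0,0,0], ![1,-1,0,0,-1,0,0], ![1,-1,0,0,0,-1,0],
   ![1,-1,0,0,0,0,-1], ![1,0,-1,-1,0,0,0], ![1,0,-1,0,-1,0,0], ![1,0,-1,0,0,-1,0],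
   ![1,0,-1,0,0,0,-1], ![1,0,0,-1,-1,0,0], ![1,0,0,-1,0,-1,0], ![1,0,0,-1,0,0,-1],
   ![1,0,0,0,-1,-1,0], ![1,0,0,0,-1,0,-1], ![1,0,0,0,0,-1,-1],
   ![2,0,-1,-1,-1,-1,-1], ![2,-1,0,-1,-1,-1,-1], ![2,-1,-1,0,-1,-1,-1], ![2,-1,-1,-1,0,-1,-1],
   ![2,-1,-1,-1,-1,0,-1], ![2,-1,-1,-1,-1,-1,0]]

theorem excList_nodup : excList.Nodup := by decide +kernel

theorem excList_exc : ∀ l ∈ excList, form l l = -1 ∧ form l kvec = -1 := by decide +kernel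

theorem excList_box : ∀ a ∈ ([0, 1, 2] : List ℤ), ∀ b ∈ ([-1, 0, 1] : List ℤ),
    ∀ c ∈ ([-1, 0, 1] : List ℤ), ∀ d ∈ ([-1, 0, 1] : List ℤ), ∀ e ∈ ([-1, 0, 1] : List ℤ),
    ∀ f ∈ ([-1, 0, 1] : List ℤ), ∀ g ∈ ([-1, 0, 1] : List ℤ),
    b + c + d + e + f + g = 1 - 3 * a →
    b * b + c * c + d * d + e * e + f * f + g * g = a * a + 1 →
    ![a, b, c, d, e, f, g] ∈ excList := by decide +kernel

theorem small_of_le (x : ℤ) (h : x * x ≤ 1 ∨ x * x ≤ x ∨ x * x ≤ -x) :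
    x ∈ ([-1, 0, 1] : List ℤ) := by
  have h1 : x < 2 := by rcases h with h | h | h <;> nlinarith
  have h2 : -2 < x := by rcases h with h | h | h <;> nlinarith
  simp; omega

theorem sq_ge (x : ℤ) : 0 ≤ x * x ∧ 0 ≤ x * x + x := by
  refine ⟨mul_self_nonneg x, ?_⟩
  rcases le_or_gt 0 x with h | h <;> nlinarith

theorem mem_excList (l : Fin 7 → ℤ) : l ∈ excList ↔ IsExc l := by
  refine ⟨fun h => excList_exc l h, fun ⟨h1, h2⟩ => ?_⟩
  rw [form_expand] at h1
  rw [form_kvec] at h2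
  have hl : l = ![l 0, l 1, l 2, l 3, l 4, l 5, l 6] := by
    ext i; fin_cases i <;> rfl
  rw [hl]
  generalize l 0 = a at *
  generalize l 1 = b at *
  generalize l 2 = c at *
  generalize l 3 = d at *
  generalize l 4 = e at *
  generalize l 5 = f at *
  generalize l 6 = g at *
  clear hl
  have hS : b + c + d + e + f + g = 1 - 3 * a := by linarith
  have hQ : b * b + c * c + d * d + e * e + f * f + g * g = a * a + 1 := by linarith
  have hSS : (b + c + d + e + f + g) ^ 2 = (1 - 3 * a) ^ 2 := by rw [hS]
  have hC : 3 * (a * a) - 6 * a - 5 ≤ 0 := by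
    linarith [sq_nonneg (b - c), sq_nonneg (b - d), sq_nonneg (b - e), sq_nonneg (b - f),
      sq_nonneg (b - g), sq_nonneg (c - d), sq_nonneg (c - e), sq_nonneg (c - f),
      sq_nonneg (c - g), sq_nonneg (d - e), sq_nonneg (d - f), sq_nonneg (d - g),
      sq_nonneg (e - f), sq_nonneg (e - g), sq_nonneg (f - g)]
  have ha1 : a < 3 := by nlinarith
  have ha2 : -1 < a := by nlinarith
  have ha : a = 0 ∨ a = 1 ∨ a = 2 := by omega
  have ⟨b1, b2⟩ := sq_ge b
  have ⟨c1, c2⟩ := sq_ge c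
  have ⟨d1, d2⟩ := sq_ge d
  have ⟨e1, e2⟩ := sq_ge e
  have ⟨f1, f2⟩ := sq_ge f
  have ⟨g1, g2⟩ := sq_ge g
  have ham : a ∈ ([0, 1, 2] : List ℤ) := by simpa using ha
  refine excList_box a ham b (small_of_le b ?_) c (small_of_le c ?_) d (small_of_le d ?_)
    e (small_of_le e ?_) f (small_of_le f ?_) g (small_of_le g ?_) hS hQ <;>
  · rcases ha with rfl | rfl | rfl
    · left; linarith
    · right; right; linarith
    · right; right; linarith

theorem sum_two (x : Fin 7 → ℤ) (hx : form x kvec = 0) :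
    (excList.map fun l => form l x ^ 2).sum = -6 * form x x := by
  rw [form_kvec] at hx
  have hx1 : x 1 = -3 * x 0 - x 2 - x 3 - x 4 - x 5 - x 6 := by linarith
  simp [excList, form_expand]
  rw [hx1]; ring

set_option maxHeartbeats 2000000 in
theorem sum_four (x y : Fin 7 → ℤ) (hx : form x kvec = 0) (hy : form y kvec = 0) :
    (excList.map fun l => form l x ^ 2 * form l y ^ 2).sum
      = form x x * form y y + 2 * form x y ^ 2 := by
  rw [form_kvec] at hx hy
  have hx1 : x 1 = -3 * x 0 - x 2 - x 3 - x 4 - x 5 - x 6 := by linarith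
  have hy1 : y 1 = -3 * y 0 - y 2 - y 3 - y 4 - y 5 - y 6 := by linarith
  simp [excList, form_expand]
  rw [hx1, hy1]; ring

theorem form_refl (r x y : Fin 7 → ℤ) (hr : IsRoot r) :
    form (reflFun r x) (reflFun r y) = form x y := by
  simp only [reflFun, form_add_left, form_smul_left, form_add_right, form_smul_right, hr.2,
    form_comm' r y]
  ring

theorem exc_refl (r x : Fin 7 → ℤ) (hr : IsRoot r) (hx : IsExc x) : IsExc (reflFun r x) := by
  refine ⟨by rw [form_refl r x x hr]; exact hx.1, ?_⟩
  simp only [reflFun, form_add_left, form_smul_left, hr.1, hx.2]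
  ring

theorem comp_eq (r r' l : Fin 7 → ℤ) (h : form r r' = 0) :
    reflFun r (reflFun r' l) = l + (form l r' • r' + form l r • r) := by
  simp only [reflFun, form_add_left, form_smul_left, form_comm' r' r, h, mul_zero, add_zero]
  rw [add_assoc]

theorem comp_invol (r r' l : Fin 7 → ℤ) (hr : IsRoot r) (hr' : IsRoot r') (h : form r r' = 0) :
    reflFun r (reflFun r' (reflFun r (reflFun r' l))) = l := by
  rw [comp_eq r r' l h, comp_eq r r' _ h]
  simp only [form_add_left, form_smul_left, form_comm' r' r, h, hr.2, hr'.2]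
  ext i
  simp only [Pi.add_apply, Pi.smul_apply, smul_eq_mul]
  ring

theorem comp_fixed (r r' l : Fin 7 → ℤ) (hr : IsRoot r) (hr' : IsRoot r') (h : form r r' = 0) :
    reflFun r (reflFun r' l) = l ↔ form l r = 0 ∧ form l r' = 0 := by
  rw [comp_eq r r' l h, add_eq_left]
  constructor
  · intro h0
    have hz : ∀ z, form 0 z = 0 := fun z => by simp [form]
    have h1 := congrArg (fun v => form v r) h0
    have h2 := congrArg (fun v => form v r') h0
    simp only [form_add_left, form_smul_left, form_comm' r' r, h, hr.2, hr'.2, hz] at h1 h2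
    constructor <;> omega
  · rintro ⟨h1, h2⟩
    simp [h1, h2]

theorem card_moved (r r' : Fin 7 → ℤ) (hr : IsRoot r) (hr' : IsRoot r') (h : form r r' = 0) :
    (excList.toFinset.filter fun l => reflFun r (reflFun r' l) ≠ l).card = 20 := by
  have hs : ∀ F : (Fin 7 → ℤ) → ℤ, ∑ l ∈ excList.toFinset, F l = (excList.map F).sum :=
    fun F => List.sum_toFinset F excList_nodup
  have key : (((excList.toFinset.filter fun l => reflFun r (reflFun r' l) ≠ l).card : ℕ) : ℤ)
      = ∑ l ∈ excList.toFinset,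
        (form l r ^ 2 + form l r' ^ 2 - form l r ^ 2 * form l r' ^ 2) := by
    rw [Finset.card_filter]
    push_cast
    refine Finset.sum_congr rfl fun l hl => ?_
    have hl' : IsExc l := (mem_excList l).1 (List.mem_toFinset.1 hl)
    simp only [ne_eq, comp_fixed r r' l hr hr' h]
    rcases form_exc_root l r hl' hr with h1 | h1 | h1 <;>
    rcases form_exc_root l r' hl' hr' with h2 | h2 | h2 <;> simp [h1, h2]
  rw [Finset.sum_sub_distrib, Finset.sum_add_distrib, hs, hs, hs, sum_two r hr.1,
    sum_two r' hr'.1, sum_four r r' hr.1 hr'.1, hr.2, hr'.2, h] at key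
  norm_num at key
  exact_mod_cast key

/-- For a syzygetic pair of roots `r, r'` (so `⟨r,r'⟩ = 0`, `r' ≠ ±r`), the composition
`s_r ∘ s_{r'}` permutes the `27` exceptional vectors, is a non-identity involution on them,
and has exactly `7` fixed points among them (so it moves `20` of them in ten disjoint
transpositions: cycle type `(2¹⁰,1⁷)`). -/
theorem stmt_8 (r r' : Fin 7 → ℤ) (hr : IsRoot r) (hr' : IsRoot r')
    (hne : r' ≠ r ∧ r' ≠ -r) (hsyz : form r r' = 0) :
    Set.BijOn (fun l => reflFun r (reflFun r' l))
      {l : Fin 7 → ℤ | IsExc l} {l : Fin 7 → ℤ | IsExc l} ∧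
    (∀ l : Fin 7 → ℤ, IsExc l →
      reflFun r (reflFun r' (reflFun r (reflFun r' l))) = l) ∧
    (∃ l : Fin 7 → ℤ, IsExc l ∧ reflFun r (reflFun r' l) ≠ l) ∧
    {l : Fin 7 → ℤ | IsExc l ∧ reflFun r (reflFun r' l) = l}.ncard = 7 ∧
    {l : Fin 7 → ℤ | IsExc l ∧ reflFun r (reflFun r' l) ≠ l}.ncard = 20 := by
  have hmap : ∀ l, IsExc l → IsExc (reflFun r (reflFun r' l)) := fun l hl =>
    exc_refl r _ hr (exc_refl r' l hr' hl)
  have hinv : ∀ l : Fin 7 → ℤ, reflFun r (reflFun r' (reflFun r (reflFun r' l))) = l :=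
    fun l => comp_invol r r' l hr hr' hsyz
  have hcard := card_moved r r' hr hr' hsyz
  have hall : excList.toFinset.card = 27 := by
    rw [List.toFinset_card_of_nodup excList_nodup]; rfl
  have hsplit := Finset.card_filter_add_card_filter_not (s := excList.toFinset)
    (fun l => reflFun r (reflFun r' l) = l)
  refine ⟨⟨fun l hl => hmap l hl, fun a _ b _ hab => ?_, fun l hl => ?_⟩,
    fun l _ => hinv l, ?_, ?_, ?_⟩
  · have hab' : reflFun r (reflFun r' a) = reflFun r (reflFun r' b) := hab
    rw [← hinv a, hab', hinv b]
  · exact ⟨_, hmap l hl, hinv l⟩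
  · obtain ⟨l, hl⟩ := Finset.card_pos.1 (by rw [hcard]; norm_num : 0 < (excList.toFinset.filter
      fun l => reflFun r (reflFun r' l) ≠ l).card)
    rw [Finset.mem_filter, List.mem_toFinset, mem_excList] at hl
    exact ⟨l, hl⟩
  · have : {l : Fin 7 → ℤ | IsExc l ∧ reflFun r (reflFun r' l) = l}
        = ↑(excList.toFinset.filter fun l => reflFun r (reflFun r' l) = l) := by
      ext l; simp [mem_excList]
    rw [this, Set.ncard_coe_finset]
    simp only [ne_eq] at hcard
    omega
  · have : {l : Fin 7 → ℤ | IsExc l ∧ reflFun r (reflFun r' l) ≠ l}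
        = ↑(excList.toFinset.filter fun l => reflFun r (reflFun r' l) ≠ l) := by
      ext l; simp [mem_excList]
    rw [this, Set.ncard_coe_finset]
    exact hcard
end
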